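/- Let (R, m) be a two-dimensional regular local ring, J an m-primary ideal of order at least 2, and x, y generators of m. Then the rank-two module M' generated by the columns of the matrix [[J, y, 0],[0, x, J]] is indecomposable; in particular, there is no surjective R-module homomorphism from M' onto m. -/

import Mathlib

open IsLocalRing

variable {R : Type*} [CommRing R]

/-- `r` lies in the integral closure of the ideal `I`. -/
def MemIntClIdeal (I : Ideal R) (r : R) : Prop :=
  ∃ n : ℕ, 0 < n ∧ ∃ c : ℕ → R, (∀ i, 1 ≤ i → i ≤ n → c i ∈ I ^ i) ∧
    r ^ n + ∑ i ∈ Finset.Icc 1 n, c i * r ^ (n - i) = 0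

/-- An ideal is integrally closed if it contains its integral closure. -/
def IsIntClIdeal (I : Ideal R) : Prop := ∀ r, MemIntClIdeal I r → r ∈ I

/-- Determinant of the 2×2 matrix with columns `v`, `w`. -/
def det2 (v w : Fin 2 → R) : R := v 0 * w 1 - v 1 * w 0

/-- The ideal of maximal minors `I(M)` of a rank-two module `M ⊆ R²`. -/
def minorsIdeal (M : Submodule R (Fin 2 → R)) : Ideal R :=
  Ideal.span {r | ∃ v ∈ M, ∃ w ∈ M, det2 v w = r}

/-- The ideal `I₁(M)` generated by the entries of a matrix whose columns generate `M`. -/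
def entriesIdeal (M : Submodule R (Fin 2 → R)) : Ideal R :=
  Ideal.span {r | ∃ v ∈ M, r = v 0 ∨ r = v 1}

/-- `v` is integral over the module `M` (Rees' determinantal criterion). -/
def MemIntClMod (M : Submodule R (Fin 2 → R)) (v : Fin 2 → R) : Prop :=
  ∀ w ∈ M, MemIntClIdeal (minorsIdeal M) (det2 v w)

/-- `M ⊆ R²` is integrally closed. -/
def IsIntClMod (M : Submodule R (Fin 2 → R)) : Prop :=
  ∀ v, MemIntClMod M v → v ∈ M

/-- `M` is indecomposable as a direct sum. -/
def IsIndecomposable (M : Submodule R (Fin 2 → R)) : Prop :=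
  ∀ N P : Submodule R (Fin 2 → R), N ⊔ P = M → N ⊓ P = ⊥ → N = ⊥ ∨ P = ⊥

/-- `M` has a nonzero free direct summand. -/
def HasFreeSummand (M : Submodule R (Fin 2 → R)) : Prop :=
  ∃ N P : Submodule R (Fin 2 → R), N ⊔ P = M ∧ N ⊓ P = ⊥ ∧ N ≠ ⊥ ∧ Module.Free R N

/-- An ideal is simple if it is not the product of two proper ideals. -/
def IsSimpleIdeal (I : Ideal R) : Prop :=
  I ≠ ⊤ ∧ ∀ J K : Ideal R, I = J * K → J = ⊤ ∨ K = ⊤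

/-- The module generated by the columns of the matrix `[[J, y, 0], [0, x, J]]`. -/
def genMod (J : Ideal R) (x y : R) : Submodule R (Fin 2 → R) :=
  Submodule.span R
    ({v | ∃ j ∈ J, v = ![j, 0]} ∪ {![y, x]} ∪ {v | ∃ j ∈ J, v = ![0, j]})

/-- In a Noetherian local ring of dimension two, no element has the maximal ideal as its radical. -/
lemma not_maximalIdeal_le_radical_span_singleton [IsNoetherianRing R] [IsLocalRing R]
    (hdim : ringKrullDim R = 2) (c : R) (hc : c ∈ maximalIdeal R) :
    ¬ maximalIdeal R ≤ (Ideal.span {c}).radical := by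
  intro h
  have hmin : maximalIdeal R ∈ (Ideal.span {c}).minimalPrimes := by
    refine ⟨⟨inferInstance, ?_⟩, fun q hq _ ↦ h.trans ((Ideal.IsPrime.radical_le_iff hq.1).2 hq.2)⟩
    simpa [Ideal.span_singleton_le_iff_mem] using hc
  have h1 := Ideal.height_le_one_of_isPrincipal_of_mem_minimalPrimes _ _ hmin
  have h2 := IsLocalRing.maximalIdeal_height_eq_ringKrullDim (R := R)
  rw [hdim, show (2 : WithBot ℕ∞) = ((2 : ℕ∞) : WithBot ℕ∞) from rfl, WithBot.coe_inj] at h2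
  rw [h2] at h1
  exact absurd h1 (by decide)

/-- The maximal ideal of a two-dimensional Noetherian local ring is not principal modulo its
square. -/
lemma not_maximalIdeal_le_span_singleton_sup_sq [IsNoetherianRing R] [IsLocalRing R]
    (hdim : ringKrullDim R = 2) (c : R) (hc : c ∈ maximalIdeal R) :
    ¬ maximalIdeal R ≤ Ideal.span {c} ⊔ maximalIdeal R ^ 2 := by
  intro h
  refine not_maximalIdeal_le_radical_span_singleton hdim c hc (le_trans ?_ Ideal.le_radical)
  refine Submodule.le_of_le_smul_of_le_jacobson_bot (I := maximalIdeal R)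
    (IsNoetherian.noetherian _) (IsLocalRing.maximalIdeal_le_jacobson _) ?_
  rwa [smul_eq_mul, ← pow_two]

/-- Generators of the maximal ideal of a two-dimensional regular local ring are linearly
independent modulo its square. -/
lemma left_mem_maximalIdeal_of_add_mem_sq [IsNoetherianRing R] [IsLocalRing R]
    (hdim : ringKrullDim R = 2) {x y : R} (hxy : Ideal.span {x, y} = maximalIdeal R) {a b : R}
    (h : a * x + b * y ∈ maximalIdeal R ^ 2) : a ∈ maximalIdeal R := by
  by_contra ha
  have hu : IsUnit a := by simpa using ha
  obtain ⟨u, rfl⟩ := hu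
  have hy : y ∈ maximalIdeal R := hxy ▸ Ideal.subset_span (by simp)
  refine not_maximalIdeal_le_span_singleton_sup_sq hdim y hy ?_
  nth_rewrite 1 [← hxy]
  rw [Ideal.span_le, Set.insert_subset_iff, Set.singleton_subset_iff]
  refine ⟨?_, Ideal.mem_sup_left (Ideal.mem_span_singleton_self y)⟩
  refine Ideal.mem_span_singleton_sup.2
    ⟨-(↑u⁻¹ * b), _, Ideal.mul_mem_left _ (↑u⁻¹ : R) h, ?_⟩
  linear_combination x * u.inv_mul

lemma pow_notMem_span_singleton [IsNoetherianRing R] [IsLocalRing R]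
    (hdim : ringKrullDim R = 2) {x y : R} (hxy : Ideal.span {x, y} = maximalIdeal R) (k : ℕ) :
    y ^ k ∉ Ideal.span {x} := by
  intro h
  have hx : x ∈ maximalIdeal R := hxy ▸ Ideal.subset_span (by simp)
  refine not_maximalIdeal_le_radical_span_singleton hdim x hx ?_
  rw [← hxy, Ideal.span_le, Set.insert_subset_iff, Set.singleton_subset_iff]
  exact ⟨Ideal.le_radical (Ideal.mem_span_singleton_self x), k, h⟩

/-- Krull's intersection theorem modulo a principal ideal. -/
lemma exists_notMem_span_pair_pow [IsNoetherianRing R] [IsLocalRing R] {x y u : R}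
    (hy : y ∈ maximalIdeal R) (hu : u ∉ Ideal.span {x}) :
    ∃ k : ℕ, u ∉ Ideal.span {x, y ^ k} := by
  by_contra! h
  have hne : Ideal.span {y} ≠ ⊤ := by
    rwa [Ne, Ideal.span_singleton_eq_top]
  have key := Ideal.iInf_pow_smul_eq_bot_of_isLocalRing (M := R ⧸ Ideal.span {x}) _ hne
  refine hu (Ideal.Quotient.eq_zero_iff_mem.1 ((Submodule.mem_bot R).1 (key ▸ ?_)))
  rw [Submodule.mem_iInf]
  intro i
  obtain ⟨a, b, hab⟩ := Ideal.mem_span_pair.1 (h i)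
  have : Ideal.Quotient.mk (Ideal.span {x}) u = y ^ i • Ideal.Quotient.mk (Ideal.span {x}) b := by
    change _ = Ideal.Quotient.mk _ (y ^ i * b)
    exact Ideal.Quotient.eq.2 (Ideal.mem_span_singleton'.2 ⟨a, by linear_combination hab⟩)
  rw [this]
  exact Submodule.smul_mem_smul (Ideal.pow_mem_pow (Ideal.mem_span_singleton_self y) i)
    Submodule.mem_top

lemma dvd_of_dvd_mul_of_span_pair_eq [IsNoetherianRing R] [IsLocalRing R]
    (hdim : ringKrullDim R = 2) {x y u : R} (hxy : Ideal.span {x, y} = maximalIdeal R)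
    (h : x ∣ y * u) : x ∣ u := by
  by_contra hu
  rw [← Ideal.mem_span_singleton] at hu
  have hy : y ∈ maximalIdeal R := hxy ▸ Ideal.subset_span (by simp)
  classical
  have hex := exists_notMem_span_pair_pow hy hu
  obtain ⟨k, hk⟩ : ∃ k, Nat.find hex = k + 1 := by
    refine Nat.exists_eq_succ_of_ne_zero fun h0 ↦ ?_
    have h1 := Nat.find_spec hex
    rw [h0] at h1
    exact h1 (Ideal.mem_span_pair.2 ⟨0, u, by ring⟩)
  have hlast := not_not.1 (Nat.find_min hex (m := k) (by omega))
  have hnot := Nat.find_spec hex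
  rw [hk] at hnot
  obtain ⟨a, b, hab⟩ := Ideal.mem_span_pair.1 hlast
  have hb : IsUnit b := by
    by_contra hb
    have hb' : b ∈ Ideal.span {x, y} := by rw [hxy]; simpa using hb
    obtain ⟨c, d, hcd⟩ := Ideal.mem_span_pair.1 hb'
    refine hnot (Ideal.mem_span_pair.2 ⟨a + c * y ^ k, d, ?_⟩)
    rw [← hab, ← hcd]
    ring
  obtain ⟨b, rfl⟩ := hb
  obtain ⟨w, hw⟩ := h
  refine pow_notMem_span_singleton hdim hxy (k + 1)
    (Ideal.mem_span_singleton'.2 ⟨↑b⁻¹ * (w - y * a), ?_⟩)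
  linear_combination -(↑b⁻¹ : R) * hw - (↑b⁻¹ : R) * y * hab + y ^ (k + 1) * b.inv_mul

lemma pow_dvd_of_pow_dvd_pow_mul_of_span_pair_eq [IsNoetherianRing R] [IsLocalRing R] [IsDomain R]
    (hdim : ringKrullDim R = 2) {x y : R} (hxy : Ideal.span {x, y} = maximalIdeal R)
    (k l : ℕ) {u : R} (h : x ^ k ∣ y ^ l * u) : x ^ k ∣ u := by
  have hyx : Ideal.span {y, x} = maximalIdeal R := by rw [Set.pair_comm, hxy]
  have hx : x ≠ 0 := fun h0 ↦ pow_notMem_span_singleton hdim hyx 1 (by simp [h0])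
  have step (l : ℕ) (v : R) (hv : x ∣ y ^ l * v) : x ∣ v := by
    induction l with
    | zero => simpa using hv
    | succ l ih =>
      exact ih (dvd_of_dvd_mul_of_span_pair_eq hdim hxy (by rwa [pow_succ', mul_assoc] at hv))
  induction k generalizing u with
  | zero => simp
  | succ k ih =>
    obtain ⟨u', rfl⟩ := step l u ((dvd_pow_self x k.succ_ne_zero).trans h)
    rw [pow_succ']
    refine mul_dvd_mul_left x (ih ((mul_dvd_mul_iff_left hx).1 ?_))
    rwa [← pow_succ', mul_left_comm]

/-- Every homomorphism from an `m`-primary ideal to the ring is multiplication by a scalar. -/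
lemma exists_eq_mul_of_radical_eq [IsNoetherianRing R] [IsLocalRing R] [IsDomain R]
    (hdim : ringKrullDim R = 2) {x y : R} (hxy : Ideal.span {x, y} = maximalIdeal R)
    {J : Ideal R} (hprim : J.radical = maximalIdeal R) (g : J →ₗ[R] R) :
    ∃ s, ∀ j : J, g j = s * j := by
  have hyx : Ideal.span {y, x} = maximalIdeal R := by rw [Set.pair_comm, hxy]
  obtain ⟨k, hk⟩ : x ∈ J.radical := by rw [hprim, ← hxy]; exact Ideal.subset_span (by simp)
  obtain ⟨l, hl⟩ : y ∈ J.radical := by rw [hprim, ← hxy]; exact Ideal.subset_span (by simp)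
  have hx : x ≠ 0 := fun h0 ↦ pow_notMem_span_singleton hdim hyx 1 (by simp [h0])
  have comm (i j : J) : (i : R) * g j = j * g i := by
    rw [← smul_eq_mul, ← smul_eq_mul, ← map_smul, ← map_smul]
    exact congrArg g (Subtype.ext (mul_comm _ _))
  obtain ⟨s, hs⟩ := pow_dvd_of_pow_dvd_pow_mul_of_span_pair_eq hdim hxy k l
    (Dvd.intro _ (comm ⟨_, hk⟩ ⟨_, hl⟩))
  refine ⟨s, fun j ↦ mul_left_cancel₀ (pow_ne_zero k hx) ?_⟩
  have := comm ⟨_, hk⟩ j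
  rw [hs] at this
  linear_combination this

lemma single_zero_mem_genMod {J : Ideal R} (x y : R) {j : R} (hj : j ∈ J) :
    ![j, 0] ∈ genMod J x y :=
  Submodule.subset_span (Or.inl (Or.inl ⟨j, hj, rfl⟩))

lemma single_one_mem_genMod {J : Ideal R} (x y : R) {j : R} (hj : j ∈ J) :
    ![0, j] ∈ genMod J x y :=
  Submodule.subset_span (Or.inr ⟨j, hj, rfl⟩)

lemma pair_mem_genMod (J : Ideal R) (x y : R) : ![y, x] ∈ genMod J x y :=
  Submodule.subset_span (Or.inl (Or.inr rfl))

lemma exists_of_mem_genMod {J : Ideal R} {x y : R} {v : Fin 2 → R} (hv : v ∈ genMod J x y) :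
    ∃ r, v 0 - r * y ∈ J ∧ v 1 - r * x ∈ J := by
  induction hv using Submodule.span_induction with
  | mem v hv =>
    rcases hv with (⟨j, hj, rfl⟩ | rfl) | ⟨j, hj, rfl⟩
    · exact ⟨0, by simpa, by simp⟩
    · exact ⟨1, by simp, by simp⟩
    · exact ⟨0, by simp, by simpa⟩
  | zero => exact ⟨0, by simp, by simp⟩
  | add v w _ _ hv hw =>
    obtain ⟨r, h0, h1⟩ := hv
    obtain ⟨s, k0, k1⟩ := hw
    refine ⟨r + s, ?_, ?_⟩
    · convert J.add_mem h0 k0 using 1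
      simp only [Pi.add_apply]
      ring
    · convert J.add_mem h1 k1 using 1
      simp only [Pi.add_apply]
      ring
  | smul a v _ hv =>
    obtain ⟨r, h0, h1⟩ := hv
    refine ⟨a * r, ?_, ?_⟩
    · convert J.mul_mem_left a h0 using 1
      simp only [Pi.smul_apply, smul_eq_mul]
      ring
    · convert J.mul_mem_left a h1 using 1
      simp only [Pi.smul_apply, smul_eq_mul]
      ring

/-- Every linear form on `genMod J x y` extends to the ambient free module. -/
lemma exists_eq_of_linearMap_genMod [IsNoetherianRing R] [IsLocalRing R] [IsDomain R]
    (hdim : ringKrullDim R = 2) {x y : R} (hxy : Ideal.span {x, y} = maximalIdeal R)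
    {J : Ideal R} (hprim : J.radical = maximalIdeal R) (f : genMod J x y →ₗ[R] R) :
    ∃ s t, ∀ v : genMod J x y, f v = s * v.1 0 + t * v.1 1 := by
  let g₀ : J →ₗ[R] R := f ∘ₗ
    { toFun := fun j ↦ ⟨![j, 0], single_zero_mem_genMod x y j.2⟩
      map_add' := fun i j ↦ by ext k; fin_cases k <;> simp
      map_smul' := fun a j ↦ by ext k; fin_cases k <;> simp }
  let g₁ : J →ₗ[R] R := f ∘ₗ
    { toFun := fun j ↦ ⟨![0, j], single_one_mem_genMod x y j.2⟩
      map_add' := fun i j ↦ by ext k; fin_cases k <;> simp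
      map_smul' := fun a j ↦ by ext k; fin_cases k <;> simp }
  obtain ⟨s, hs⟩ := exists_eq_mul_of_radical_eq hdim hxy hprim g₀
  obtain ⟨t, ht⟩ := exists_eq_mul_of_radical_eq hdim hxy hprim g₁
  have hyx : Ideal.span {y, x} = maximalIdeal R := by rw [Set.pair_comm, hxy]
  have hx : x ≠ 0 := fun h0 ↦ pow_notMem_span_singleton hdim hyx 1 (by simp [h0])
  obtain ⟨k, hk⟩ : x ∈ J.radical := by rw [hprim, ← hxy]; exact Ideal.subset_span (by simp)
  refine ⟨s, t, fun v ↦ mul_left_cancel₀ (pow_ne_zero k hx) ?_⟩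
  have h0 := hs ⟨x ^ k * v.1 0, J.mul_mem_right _ hk⟩
  have h1 := ht ⟨x ^ k * v.1 1, J.mul_mem_right _ hk⟩
  have hsum : x ^ k • v =
      (⟨![x ^ k * v.1 0, 0], single_zero_mem_genMod x y (J.mul_mem_right _ hk)⟩ : genMod J x y) +
        ⟨![0, x ^ k * v.1 1], single_one_mem_genMod x y (J.mul_mem_right _ hk)⟩ := by
    ext i
    fin_cases i <;> simp
  have h2 := congrArg f hsum
  rw [map_add, map_smul, smul_eq_mul] at h2
  rw [h2]
  refine (congrArg₂ (· + ·) h0 h1).trans ?_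
  ring

lemma eq_zero_of_isUnit_det {a b c d v w : R} (hu : IsUnit (a * d - b * c))
    (h0 : a * v + b * w = 0) (h1 : c * v + d * w = 0) : v = 0 ∧ w = 0 := by
  constructor <;> refine hu.mul_right_eq_zero.1 ?_
  · linear_combination d * h0 - b * h1
  · linear_combination a * h1 - c * h0

theorem stmt9 [IsNoetherianRing R] [IsLocalRing R] [IsDomain R]
    (hdim : ringKrullDim R = 2)
    (hreg : ∃ x' y' : R, maximalIdeal R = Ideal.span {x', y'})
    (J : Ideal R) (hprim : J.radical = maximalIdeal R)
    (hord : J ≤ maximalIdeal R ^ 2)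
    (x y : R) (hxy : Ideal.span {x, y} = maximalIdeal R) :
    IsIndecomposable (genMod J x y) ∧
      ¬ ∃ f : (genMod J x y) →ₗ[R] R, LinearMap.range f = maximalIdeal R := by
  have hx : x ∈ maximalIdeal R := hxy ▸ Ideal.subset_span (by simp)
  have hy : y ∈ maximalIdeal R := hxy ▸ Ideal.subset_span (by simp)
  have hyx : Ideal.span {y, x} = maximalIdeal R := by rw [Set.pair_comm, hxy]
  constructor
  · intro N P hsup hinf
    have hNM : N ≤ genMod J x y := hsup ▸ le_sup_left
    have hPM : P ≤ genMod J x y := hsup ▸ le_sup_right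
    have hcompl : IsCompl (N.submoduleOf (genMod J x y)) (P.submoduleOf (genMod J x y)) := by
      refine IsCompl.of_eq ?_ ?_
      · rw [eq_bot_iff]
        rintro v ⟨hN, hP⟩
        have : v.1 ∈ N ⊓ P := ⟨hN, hP⟩
        rw [hinf, Submodule.mem_bot] at this
        exact Subtype.ext this
      · rw [eq_top_iff]
        rintro v -
        have hv : v.1 ∈ N ⊔ P := by rw [hsup]; exact v.2
        obtain ⟨n, hn, p, hp, h⟩ := Submodule.mem_sup.1 hv
        exact Submodule.mem_sup.2 ⟨⟨n, hNM hn⟩, hn, ⟨p, hPM hp⟩, hp, Subtype.ext h⟩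
    let φ := (N.submoduleOf (genMod J x y)).projection _ hcompl
    obtain ⟨a, b, hab⟩ := exists_eq_of_linearMap_genMod hdim hxy hprim
      (LinearMap.proj 0 ∘ₗ (genMod J x y).subtype ∘ₗ φ)
    obtain ⟨c, d, hcd⟩ := exists_eq_of_linearMap_genMod hdim hxy hprim
      (LinearMap.proj 1 ∘ₗ (genMod J x y).subtype ∘ₗ φ)
    simp only [LinearMap.comp_apply, LinearMap.proj_apply, Submodule.subtype_apply] at hab hcd
    obtain ⟨r, hr0, hr1⟩ := exists_of_mem_genMod (φ ⟨_, pair_mem_genMod J x y⟩).2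
    rw [hab] at hr0
    rw [hcd] at hr1
    simp only [Matrix.cons_val_zero, Matrix.cons_val_one] at hr0 hr1
    have har : a - r ∈ maximalIdeal R := left_mem_maximalIdeal_of_add_mem_sq hdim hyx (b := b)
      (by convert hord hr0 using 1; ring)
    have hb : b ∈ maximalIdeal R := left_mem_maximalIdeal_of_add_mem_sq hdim hxy (b := a - r)
      (by convert hord hr0 using 1; ring)
    have hdr : d - r ∈ maximalIdeal R := left_mem_maximalIdeal_of_add_mem_sq hdim hxy (b := c)
      (by convert hord hr1 using 1; ring)
    simp only [← residue_eq_zero_iff, map_sub, sub_eq_zero] at har hb hdr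
    by_cases hdet : IsUnit (a * d - b * c)
    · right
      rw [eq_bot_iff]
      intro v hv
      have h0 : φ ⟨v, hPM hv⟩ = 0 := (Submodule.projection_apply_eq_zero_iff hcompl).2 hv
      have e0 := hab ⟨v, hPM hv⟩
      have e1 := hcd ⟨v, hPM hv⟩
      rw [h0] at e0 e1
      obtain ⟨k0, k1⟩ := eq_zero_of_isUnit_det hdet e0.symm e1.symm
      rw [Submodule.mem_bot]
      ext i
      fin_cases i
      exacts [k0, k1]
    · left
      have hdet' : IsUnit ((1 - a) * (1 - d) - (-b) * (-c)) := by
        rw [← mem_nonunits_iff, ← mem_maximalIdeal, ← residue_eq_zero_iff] at hdet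
        simp only [map_sub, map_mul, har, hb, hdr, zero_mul, sub_zero, mul_self_eq_zero] at hdet
        rw [← residue_ne_zero_iff_isUnit]
        simp [har, hb, hdr, hdet]
      rw [eq_bot_iff]
      intro v hv
      have h0 : φ ⟨v, hNM hv⟩ = ⟨v, hNM hv⟩ := Submodule.projection_apply_of_mem_left hcompl hv
      have e0 := hab ⟨v, hNM hv⟩
      have e1 := hcd ⟨v, hNM hv⟩
      rw [h0] at e0 e1
      obtain ⟨k0, k1⟩ := eq_zero_of_isUnit_det (v := v 0) (w := v 1) hdet'
        (by linear_combination e0) (by linear_combination e1)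
      rw [Submodule.mem_bot]
      ext i
      fin_cases i
      exacts [k0, k1]
  · rintro ⟨f, hf⟩
    obtain ⟨s, t, hst⟩ := exists_eq_of_linearMap_genMod hdim hxy hprim f
    refine not_maximalIdeal_le_span_singleton_sup_sq hdim (s * y + t * x)
      (add_mem (Ideal.mul_mem_left _ _ hy) (Ideal.mul_mem_left _ _ hx)) ?_
    rw [← hf]
    rintro _ ⟨v, rfl⟩
    obtain ⟨r, h0, h1⟩ := exists_of_mem_genMod v.2
    rw [hf]
    refine Ideal.mem_span_singleton_sup.2 ⟨r, s * (v.1 0 - r * y) + t * (v.1 1 - r * x),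
      add_mem (Ideal.mul_mem_left _ _ (hord h0)) (Ideal.mul_mem_left _ _ (hord h1)), ?_⟩
    rw [hst]
    ring
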